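/- Let n ≥ 2 and let ω = exp(2πi/n). For each k = 1, …, n let z_k = t_k·ω^k with t_k > 0, and set t_{n+1} = t_1. Then ∏_{k≠l} |z_k − z_l| ≥ (n/2)^n · ∏_{k=1}^n t_k^{n/2−1}·(t_k^{n/2} + t_{k+1}^{n/2}), where the product on the left ranges over all ordered pairs (k,l) with k ≠ l, and the real powers t^{n/2−1}, t^{n/2} are real powers of positive reals. Equality holds when all t_k are equal. -/

import Mathlib

section DubininAux
open MeasureTheory Set Filter Topology

lemma dub_ftc (g g' : ℝ → ℝ) (a l : ℝ) (hd : ∀ x ∈ Ici a, HasDerivAt g (g' x) x)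
    (hpos : ∀ x ∈ Ioi a, 0 ≤ g' x) (hl : Tendsto g atTop (𝓝 l)) :
    ∫⁻ x in Ioi a, ENNReal.ofReal (g' x) = ENNReal.ofReal (l - g a) := by
  rw [← ofReal_integral_eq_lintegral_ofReal]
  · rw [integral_Ioi_of_hasDerivAt_of_nonneg' hd hpos hl]
  · exact integrableOn_Ioi_deriv_of_nonneg' hd hpos hl
  · exact (ae_restrict_iff' measurableSet_Ioi).2 (ae_of_all _ hpos)

lemma dub_exp_tendsto (s : ℝ) (hs : 0 < s) : Tendsto (fun x : ℝ => Real.exp (-(s * x))) atTop (𝓝 0) :=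
  Real.tendsto_exp_neg_atTop_nhds_zero.comp (tendsto_id.const_mul_atTop hs)

lemma dub_L1 (s y : ℝ) (hs : 0 < s) :
    ∫⁻ ξ in Ioi (0:ℝ), ENNReal.ofReal (Real.exp (-(s * ξ)) * (1 - Real.cos (ξ * y)))
      = ENNReal.ofReal (1 / s - s / (s ^ 2 + y ^ 2)) := by
  have hq : s ^ 2 + y ^ 2 ≠ 0 := by positivity
  have := dub_ftc (fun ξ => Real.exp (-(s * ξ)) *
      (-(1 / s) + (s * Real.cos (ξ * y) - y * Real.sin (ξ * y)) / (s ^ 2 + y ^ 2)))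
    (fun ξ => Real.exp (-(s * ξ)) * (1 - Real.cos (ξ * y))) 0 0 ?_ ?_ ?_
  · rw [this]; congr 1; simp; ring
  · intro x _
    have h1 : HasDerivAt (fun ξ : ℝ => Real.exp (-(s * ξ))) (Real.exp (-(s * x)) * (-(s * 1))) x :=
      (((hasDerivAt_id x).const_mul s).neg).exp
    have h0 : HasDerivAt (fun ξ : ℝ => ξ * y) (1 * y) x := (hasDerivAt_id x).mul_const y
    have h2 := (((h0.cos.const_mul s).sub (h0.sin.const_mul y)).div_const (s ^ 2 + y ^ 2)).const_add (-(1 / s))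
    refine (h1.mul h2).congr_deriv ?_
    try simp only [Pi.sub_apply]
    field_simp
    ring
  · intro x _
    exact mul_nonneg (Real.exp_pos _).le (by linarith [Real.cos_le_one (x * y)])
  · refine (dub_exp_tendsto s hs).zero_mul_isBoundedUnder_le ?_
    refine isBoundedUnder_of ⟨1 / s + (s + |y|) / (s ^ 2 + y ^ 2), fun x => ?_⟩
    simp only [Function.comp, Real.norm_eq_abs]
    refine (abs_add_le _ _).trans ?_
    rw [abs_neg, abs_of_pos (by positivity : 0 < 1 / s), abs_div, abs_of_pos (by positivity : 0 < s ^ 2 + y ^ 2)]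
    gcongr
    refine (abs_sub _ _).trans ?_
    rw [abs_mul, abs_mul, abs_of_pos hs]
    have := Real.abs_cos_le_one (x * y)
    have := Real.abs_sin_le_one (x * y)
    have := abs_nonneg y
    nlinarith

lemma dub_L2 (c y : ℝ) (hc : 0 < c) :
    ∫⁻ s in Ioi c, ENNReal.ofReal (1 / s - s / (s ^ 2 + y ^ 2))
      = ENNReal.ofReal (Real.log (1 + y ^ 2 / c ^ 2) / 2) := by
  have := dub_ftc (fun s => -(Real.log (1 + y ^ 2 / s ^ 2) / 2))
    (fun s => 1 / s - s / (s ^ 2 + y ^ 2)) c 0 ?_ ?_ ?_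
  · rw [this]; congr 1; ring
  · intro x hx
    have hx : 0 < x := lt_of_lt_of_le hc hx
    have h1 : HasDerivAt (fun s : ℝ => 1 + y ^ 2 / s ^ 2) (-(2 * y ^ 2 / x ^ 3)) x := by
      have := ((hasDerivAt_const x (y ^ 2)).div (hasDerivAt_pow 2 x) (by positivity)).const_add 1
      refine this.congr_deriv ?_
      field_simp
      norm_num
      ring
    have h2 := ((h1.log (by positivity)).div_const 2).neg
    refine h2.congr_deriv ?_
    field_simp
    ring
  · intro x hx
    have hx : 0 < x := lt_trans hc hx
    rw [sub_nonneg, div_le_div_iff₀ (by positivity) hx]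
    nlinarith [sq_nonneg y]
  · have h : Tendsto (fun s : ℝ => 1 + y ^ 2 / s ^ 2) atTop (𝓝 (1 + 0)) :=
      (tendsto_const_nhds.div_atTop (tendsto_pow_atTop (by norm_num))).const_add 1
    have := ((h.log (by norm_num)).div_const 2).neg
    simpa using this

lemma dub_L3 (c y ξ : ℝ) (hξ : 0 < ξ) :
    ∫⁻ s in Ioi c, ENNReal.ofReal (Real.exp (-(s * ξ)) * (1 - Real.cos (ξ * y)))
      = ENNReal.ofReal (Real.exp (-(c * ξ)) * ((1 - Real.cos (ξ * y)) / ξ)) := by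
  have := dub_ftc (fun s => -(Real.exp (-(ξ * s)) * ((1 - Real.cos (ξ * y)) / ξ)))
    (fun s => Real.exp (-(s * ξ)) * (1 - Real.cos (ξ * y))) c 0 ?_ ?_ ?_
  · rw [this]; congr 1; rw [mul_comm ξ c]; ring
  · intro x _
    have h1 : HasDerivAt (fun s : ℝ => Real.exp (-(ξ * s))) (Real.exp (-(ξ * x)) * (-(ξ * 1))) x :=
      (((hasDerivAt_id x).const_mul ξ).neg).exp
    refine (h1.mul_const ((1 - Real.cos (ξ * y)) / ξ)).neg.congr_deriv ?_
    rw [mul_comm x ξ]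
    field_simp
  · intro x _
    exact mul_nonneg (Real.exp_pos _).le (by linarith [Real.cos_le_one (ξ * y)])
  · simpa using ((dub_exp_tendsto ξ hξ).mul_const ((1 - Real.cos (ξ * y)) / ξ)).neg

lemma dub_L4 (c y : ℝ) (hc : 0 < c) :
    ∫⁻ ξ in Ioi (0:ℝ), ENNReal.ofReal (Real.exp (-(c * ξ)) * ((1 - Real.cos (ξ * y)) / ξ))
      = ENNReal.ofReal (Real.log (1 + y ^ 2 / c ^ 2) / 2) := by
  rw [← dub_L2 c y hc]
  rw [setLIntegral_congr_fun measurableSet_Ioi (fun ξ hξ => (dub_L3 c y ξ hξ).symm)]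
  rw [lintegral_lintegral_swap]
  · exact setLIntegral_congr_fun measurableSet_Ioi (fun s hs => dub_L1 s y (lt_trans hc hs))
  · apply Measurable.aemeasurable
    fun_prop

lemma dub_L5 (a y : ℝ) (ha : 0 < a) (ha1 : a < 1) :
    HasSum (fun p : ℕ => Real.log (1 + y ^ 2 / (a + p) ^ 2) + Real.log (1 + y ^ 2 / (1 - a + p) ^ 2))
      (Real.log ((Real.cosh (2 * Real.pi * y) - Real.cos (2 * Real.pi * a)) / (1 - Real.cos (2 * Real.pi * a)))) := by
  have hnn : ∀ c : ℝ, 0 ≤ Real.log (1 + y ^ 2 / c ^ 2) := fun c =>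
    Real.log_nonneg (by have : 0 ≤ y ^ 2 / c ^ 2 := by positivity
                        linarith)
  have hsin : 0 < Real.sin (Real.pi * a) :=
    Real.sin_pos_of_pos_of_lt_pi (by positivity) (by nlinarith [Real.pi_pos])
  have hnorm : ∀ b : ℝ, ‖Complex.sin (Real.pi * (⟨a, b⟩ : ℂ))‖ ^ 2 =
      (Real.cosh (2 * Real.pi * b) - Real.cos (2 * Real.pi * a)) / 2 := by
    intro b
    have : (Real.pi * (⟨a, b⟩ : ℂ)) = ((Real.pi * a : ℝ) : ℂ) + ((Real.pi * b : ℝ) : ℂ) * Complex.I := by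
      apply Complex.ext <;> simp
    rw [this, Complex.sin_add_mul_I, ← Complex.ofReal_sin, ← Complex.ofReal_cos, ← Complex.ofReal_sinh,
      ← Complex.ofReal_cosh, ← Complex.normSq_eq_norm_sq, Complex.normSq_apply]
    simp only [Complex.add_re, Complex.add_im, Complex.mul_re, Complex.mul_im, Complex.ofReal_re,
      Complex.ofReal_im, Complex.I_re, Complex.I_im]
    rw [mul_assoc 2 Real.pi b, mul_assoc 2 Real.pi a, Real.cosh_two_mul, Real.cos_two_mul]
    have h1 := Real.sin_sq_add_cos_sq (Real.pi * a)
    have h2 := Real.cosh_sq (Real.pi * b)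
    have h1' : Real.sin (Real.pi * a) ^ 2 = 1 - Real.cos (Real.pi * a) ^ 2 := by linarith
    ring_nf
    ring_nf at h1' h2
    rw [h1', h2]; ring
  rw [hasSum_iff_tendsto_nat_of_nonneg (fun p => add_nonneg (hnn _) (hnn _))]
  have e1 := ((Complex.tendsto_euler_sin_prod ⟨a, y⟩).norm.pow 2)
  have e2 := ((Complex.tendsto_euler_sin_prod ⟨a, 0⟩).norm.pow 2)
  rw [hnorm] at e1 e2
  have hc0 : 0 < 1 - Real.cos (2 * Real.pi * a) := by
    rw [mul_assoc, Real.cos_two_mul]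
    nlinarith [Real.sin_sq_add_cos_sq (Real.pi * a)]
  have hc1 : 0 < Real.cosh (2 * Real.pi * y) - Real.cos (2 * Real.pi * a) := by
    linarith [Real.one_le_cosh (2 * Real.pi * y)]
  simp only [mul_zero, Real.cosh_zero] at e2
  have e3 := (e1.div e2 (by positivity)).log (by positivity)
  have e4 : Tendsto (fun n : ℕ => Real.log (1 + y ^ 2 / (a + n) ^ 2)) atTop (𝓝 0) := by
    have h : Tendsto (fun s : ℝ => 1 + y ^ 2 / s ^ 2) atTop (𝓝 (1 + 0)) :=
      (tendsto_const_nhds.div_atTop (tendsto_pow_atTop (by norm_num))).const_add 1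
    have := (h.log (by norm_num)).comp (tendsto_atTop_add_const_left atTop a tendsto_natCast_atTop_atTop)
    simpa [Function.comp_def] using this
  have e5 := e3.sub e4
  rw [sub_zero, div_div_div_cancel_right₀ (by norm_num)] at e5
  refine e5.congr (fun N => ?_)
  simp only [Pi.div_apply]
  have key : ∀ j : ℕ, ‖(1 : ℂ) - (⟨a, y⟩ : ℂ) ^ 2 / ((j : ℂ) + 1) ^ 2‖ ^ 2 / ‖(1 : ℂ) - (⟨a, 0⟩ : ℂ) ^ 2 / ((j : ℂ) + 1) ^ 2‖ ^ 2
      = (1 + y ^ 2 / (a + (j + 1)) ^ 2) * (1 + y ^ 2 / (1 - a + j) ^ 2) := by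
    intro j
    have hj : ∀ b : ℝ, ‖(1 : ℂ) - (⟨a, b⟩ : ℂ) ^ 2 / ((j : ℂ) + 1) ^ 2‖ ^ 2 =
        ((a + (j + 1)) ^ 2 + b ^ 2) * ((1 - a + j) ^ 2 + b ^ 2) / (j + 1) ^ 4 := by
      intro b
      have hz : ((j : ℂ) + 1) ≠ 0 := by exact_mod_cast Nat.succ_ne_zero j
      have : (1 : ℂ) - (⟨a, b⟩ : ℂ) ^ 2 / ((j : ℂ) + 1) ^ 2 =
        (⟨1 - a + j, -b⟩ * ⟨a + (j + 1), b⟩) / (((j + 1 : ℝ)) : ℂ) ^ 2 := by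
        have q1 : (⟨1 - a + j, -b⟩ : ℂ) = (j + 1) - ⟨a, b⟩ := by
          apply Complex.ext <;> simp; ring
        have q2 : (⟨a + (j + 1), b⟩ : ℂ) = (j + 1) + ⟨a, b⟩ := by
          apply Complex.ext <;> simp; ring
        rw [q1, q2]; push_cast; field_simp; ring
      rw [this, ← Complex.normSq_eq_norm_sq, map_div₀, map_mul, map_pow, Complex.normSq_ofReal,
        Complex.normSq_mk, Complex.normSq_mk]
      ring
    rw [hj, hj]
    have : 0 < 1 - a + j := by have : (0:ℝ) ≤ j := by positivity
                               linarith
    field_simp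
    ring
  have hz : ‖(⟨a, y⟩ : ℂ)‖ ^ 2 / ‖(⟨a, 0⟩ : ℂ)‖ ^ 2 = 1 + y ^ 2 / a ^ 2 := by
    rw [← Complex.normSq_eq_norm_sq, ← Complex.normSq_eq_norm_sq, Complex.normSq_mk, Complex.normSq_mk]
    field_simp
    ring
  have : (‖(Real.pi : ℂ) * (⟨a, y⟩ : ℂ) * ∏ j ∈ Finset.range N, (1 - (⟨a, y⟩ : ℂ) ^ 2 / ((j : ℂ) + 1) ^ 2)‖ ^ 2 /
      ‖(Real.pi : ℂ) * (⟨a, 0⟩ : ℂ) * ∏ j ∈ Finset.range N, (1 - (⟨a, 0⟩ : ℂ) ^ 2 / ((j : ℂ) + 1) ^ 2)‖ ^ 2)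
      = (1 + y ^ 2 / a ^ 2) * ∏ j ∈ Finset.range N, ((1 + y ^ 2 / (a + (j + 1)) ^ 2) * (1 + y ^ 2 / (1 - a + j) ^ 2)) := by
    rw [← hz, Finset.prod_congr rfl (fun j _ => (key j).symm), Finset.prod_div_distrib,
      norm_mul, norm_mul, norm_mul, norm_mul, norm_prod, norm_prod, mul_pow, mul_pow, mul_pow, mul_pow,
      ← Finset.prod_pow, ← Finset.prod_pow]
    have : ‖(Real.pi : ℂ)‖ ^ 2 ≠ 0 := by simp [Real.pi_ne_zero]
    rw [mul_assoc, mul_assoc, mul_div_mul_left _ _ this, mul_div_mul_comm]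
  rw [this, Real.log_mul (by positivity) (by positivity), Real.log_prod (fun i _ => by positivity)]
  have s1 : ∑ i ∈ Finset.range N, Real.log ((1 + y ^ 2 / (a + (i + 1)) ^ 2) * (1 + y ^ 2 / (1 - a + i) ^ 2))
    = ∑ i ∈ Finset.range N, (Real.log (1 + y ^ 2 / (a + (i + 1)) ^ 2) + Real.log (1 + y ^ 2 / (1 - a + i) ^ 2)) :=
    Finset.sum_congr rfl (fun i _ => Real.log_mul (by positivity) (by positivity))
  rw [s1, Finset.sum_add_distrib, Finset.sum_add_distrib]
  have s2 := Finset.sum_range_succ (fun i : ℕ => Real.log (1 + y ^ 2 / (a + i) ^ 2)) N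
  rw [Finset.sum_range_succ'] at s2
  push_cast at s2
  rw [add_zero] at s2
  linarith

lemma dub_L6 (n e : ℕ) (he : 0 < e) (hen : e < n) (y : ℝ) :
    ∫⁻ ξ in Ioi (0:ℝ), ENNReal.ofReal ((1 - Real.cos (ξ * y)) / ξ *
      ((Real.exp (-ξ) ^ e + Real.exp (-ξ) ^ (n - e)) / (1 - Real.exp (-ξ) ^ n)))
      = ENNReal.ofReal (Real.log ((Real.cosh (2 * Real.pi * y / n) - Real.cos (2 * Real.pi * e / n)) /
          (1 - Real.cos (2 * Real.pi * e / n))) / 2) := by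
  have hn : (0:ℝ) < n := by exact_mod_cast (by omega : 0 < n)
  have he' : (0:ℝ) < e := by exact_mod_cast he
  have hen' : (e:ℝ) < n := by exact_mod_cast hen
  have hnn : ∀ c : ℝ, 0 ≤ Real.log (1 + y ^ 2 / c ^ 2) := fun c =>
    Real.log_nonneg (by have : 0 ≤ y ^ 2 / c ^ 2 := by positivity
                        linarith)
  have h5 := (dub_L5 (e / n) (y / n) (by positivity) (by rw [div_lt_one hn]; exact hen')).div_const 2
  rw [← mul_div_assoc, ← mul_div_assoc] at h5
  have h6 : ∀ p : ℕ, (Real.log (1 + (y / n) ^ 2 / (e / n + p) ^ 2) + Real.log (1 + (y / n) ^ 2 / (1 - e / n + p) ^ 2)) / 2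
     = Real.log (1 + y ^ 2 / (e + n * p) ^ 2) / 2 + Real.log (1 + y ^ 2 / ((n - e) + n * p) ^ 2) / 2 := by
    intro p
    have : (0:ℝ) < n - e := by linarith
    rw [add_div]
    congr 4
    · have : (e / n + p : ℝ) = (e + n * p) / n := by field_simp
      rw [this]; field_simp
    · have : (1 - e / n + p : ℝ) = ((n - e) + n * p) / n := by field_simp
      rw [this]; field_simp
  simp only [h6] at h5
  rw [← h5.tsum_eq, ENNReal.ofReal_tsum_of_nonneg (fun p => add_nonneg (div_nonneg (hnn _) (by norm_num)) (div_nonneg (hnn _) (by norm_num))) h5.summable]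
  have h7 : ∀ p : ℕ, ENNReal.ofReal (Real.log (1 + y ^ 2 / (e + n * p) ^ 2) / 2 + Real.log (1 + y ^ 2 / ((n - e) + n * p) ^ 2) / 2)
     = ∫⁻ ξ in Ioi (0:ℝ), (ENNReal.ofReal (Real.exp (-((e + n * p) * ξ)) * ((1 - Real.cos (ξ * y)) / ξ)) +
         ENNReal.ofReal (Real.exp (-(((n - e) + n * p) * ξ)) * ((1 - Real.cos (ξ * y)) / ξ))) := by
    intro p
    have : (0:ℝ) < n - e := by linarith
    rw [lintegral_add_left (by fun_prop), dub_L4 _ _ (by positivity), dub_L4 _ _ (by positivity),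
      ENNReal.ofReal_add (div_nonneg (hnn _) (by norm_num)) (div_nonneg (hnn _) (by norm_num))]
  simp only [h7]
  rw [← lintegral_tsum (fun p => by fun_prop)]
  refine setLIntegral_congr_fun measurableSet_Ioi (fun ξ hξ => ?_)
  have hξ : 0 < ξ := hξ
  have hr1 : Real.exp (-ξ) ^ n < 1 := pow_lt_one₀ (Real.exp_pos _).le (by simpa using hξ) (by omega)
  have hcn : 0 ≤ (1 - Real.cos (ξ * y)) / ξ := div_nonneg (by linarith [Real.cos_le_one (ξ * y)]) hξ.le
  have g := (((hasSum_geometric_of_lt_one (by positivity) hr1).mul_left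
    (Real.exp (-ξ) ^ e + Real.exp (-ξ) ^ (n - e))).mul_left ((1 - Real.cos (ξ * y)) / ξ))
  rw [← div_eq_mul_inv] at g
  rw [← g.tsum_eq, ENNReal.ofReal_tsum_of_nonneg (fun p => by positivity) g.summable]
  congr 1
  funext p
  rw [← ENNReal.ofReal_add (by positivity) (by positivity)]
  congr 1
  rw [← Real.exp_nat_mul, ← Real.exp_nat_mul, ← Real.exp_nat_mul, ← Real.exp_nat_mul, Nat.cast_sub hen.le,
    add_mul, mul_comm, ← Real.exp_add, ← Real.exp_add, add_mul]
  congr 2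
  · congr 1; ring
  · congr 1; ring

lemma dub_shift (n : ℕ) (g : ℕ → ℝ) (hg : ∀ k, g (k + n) = g k) :
    ∑ k ∈ Finset.range n, g (k + 1) = ∑ k ∈ Finset.range n, g k := by
  have h1 := Finset.sum_range_succ g n
  rw [Finset.sum_range_succ'] at h1
  have := hg 0
  rw [zero_add] at this
  linarith

lemma dub_shift' (n : ℕ) (g : ℕ → ℝ) (hg : ∀ k, g (k + n) = g k) (d : ℕ) :
    ∑ k ∈ Finset.range n, g (k + d) = ∑ k ∈ Finset.range n, g k := by
  induction d with
  | zero => rfl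
  | succ d ih =>
    rw [← ih, ← dub_shift n (fun k => g (k + d))]
    · exact Finset.sum_congr rfl (fun k _ => by congr 1; ring)
    · intro k
      rw [← hg (k + d)]; congr 1; ring

/-- key quadratic form inequality -/
lemma dub_quad (n : ℕ) (r : ℝ) (h0 : 0 < r) (h1 : r < 1) (hn : n ≠ 0) (v : ℕ → ℝ)
    (hv : ∀ k, v (k + n) = v k) :
    (r / (1 - r ^ 2)) * ∑ k ∈ Finset.range n, (v k - v (k + 1)) ^ 2 ≤
    (∑ k ∈ Finset.range n, ∑ d ∈ Finset.range n, r ^ d * (v k - v (k + d)) ^ 2) / (1 - r ^ n) := by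
  have hrn : r ^ n < 1 := pow_lt_one₀ h0.le h1 hn
  have hrn' : 1 - r ^ n ≠ 0 := by linarith
  have hr1 : 1 - r ≠ 0 := by linarith
  obtain ⟨w, hw⟩ : ∃ w : ℕ → ℝ, ∀ k, w k = (∑ d ∈ Finset.range n, r ^ d * v (k + d)) / (1 - r ^ n) :=
    ⟨_, fun _ => rfl⟩
  have hwp : ∀ k, w (k + n) = w k := by
    intro k
    rw [hw, hw]; congr 1
    exact Finset.sum_congr rfl (fun d _ => by rw [add_right_comm, hv])
  have hvw : ∀ k, v k = w k - r * w (k + 1) := by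
    intro k
    rw [hw, hw]
    have a1 := Finset.sum_range_succ (fun d => r ^ d * v (k + d)) n
    rw [Finset.sum_range_succ'] at a1
    have a2 : r * ∑ d ∈ Finset.range n, r ^ d * v (k + 1 + d) =
        ∑ d ∈ Finset.range n, r ^ (d + 1) * v (k + (d + 1)) := by
      rw [Finset.mul_sum]
      refine Finset.sum_congr rfl (fun d _ => ?_)
      rw [show k + 1 + d = k + (d + 1) by ring]; ring
    rw [hv] at a1
    simp only [pow_zero, add_zero, one_mul] at a1
    rw [← mul_div_assoc, a2, ← sub_div, eq_div_iff hrn']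
    linarith
  -- expand the double sum
  have E : ∑ k ∈ Finset.range n, ∑ d ∈ Finset.range n, r ^ d * (v k - v (k + d)) ^ 2 =
     (1 - r ^ n) * (2 * (∑ k ∈ Finset.range n, v k ^ 2) / (1 - r) - 2 * ∑ k ∈ Finset.range n, v k * w k) := by
    have b1 : ∀ k, ∑ d ∈ Finset.range n, r ^ d * (v k - v (k + d)) ^ 2 =
      (∑ d ∈ Finset.range n, r ^ d) * v k ^ 2 + ∑ d ∈ Finset.range n, r ^ d * v (k + d) ^ 2
        - 2 * (1 - r ^ n) * (v k * w k) := by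
      intro k
      have : 2 * (1 - r ^ n) * (v k * w k) = ∑ d ∈ Finset.range n, 2 * v k * (r ^ d * v (k + d)) := by
        rw [← Finset.mul_sum, hw]; field_simp
      rw [this, Finset.sum_mul, ← Finset.sum_add_distrib, ← Finset.sum_sub_distrib]
      exact Finset.sum_congr rfl (fun d _ => by ring)
    have b2 : ∑ k ∈ Finset.range n, ∑ d ∈ Finset.range n, r ^ d * v (k + d) ^ 2 =
       (∑ d ∈ Finset.range n, r ^ d) * ∑ k ∈ Finset.range n, v k ^ 2 := by
      rw [Finset.sum_comm, Finset.sum_mul]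
      refine Finset.sum_congr rfl (fun d _ => ?_)
      rw [← Finset.mul_sum, dub_shift' n (fun k => v k ^ 2) (fun k => by rw [hv])]
    have b3 : ∑ d ∈ Finset.range n, r ^ d = (1 - r ^ n) / (1 - r) := by
      rw [geom_sum_eq (by linarith), ← neg_sub, ← neg_sub 1 r, neg_div_neg_eq]
    rw [Finset.sum_congr rfl (fun k _ => b1 k), Finset.sum_sub_distrib, Finset.sum_add_distrib, b2,
      ← Finset.mul_sum, ← Finset.mul_sum, b3]
    field_simp
    ring
  rw [E, mul_div_cancel_left₀ _ hrn']
  -- shifts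
  set N := ∑ k ∈ Finset.range n, w k ^ 2 with hN
  set C1 := ∑ k ∈ Finset.range n, w k * w (k + 1) with hC1
  set C2 := ∑ k ∈ Finset.range n, w k * w (k + 2) with hC2
  have N1 : ∑ k ∈ Finset.range n, w (k + 1) ^ 2 = N :=
    dub_shift' n (fun k => w k ^ 2) (fun k => by rw [hwp]) 1
  have N2 : ∑ k ∈ Finset.range n, w (k + 2) ^ 2 = N :=
    dub_shift' n (fun k => w k ^ 2) (fun k => by rw [hwp]) 2
  have C11 : ∑ k ∈ Finset.range n, w (k + 1) * w (k + 2) = C1 :=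
    dub_shift' n (fun k => w k * w (k + 1)) (fun k => by rw [hwp, add_right_comm, hwp]) 1
  have V : ∑ k ∈ Finset.range n, v k ^ 2 = (1 + r ^ 2) * N - 2 * r * C1 := by
    have : ∑ k ∈ Finset.range n, v k ^ 2 = ∑ k ∈ Finset.range n,
      (w k ^ 2 + r ^ 2 * w (k + 1) ^ 2 - 2 * r * (w k * w (k + 1))) :=
      Finset.sum_congr rfl (fun k _ => by rw [hvw]; ring)
    rw [this, Finset.sum_sub_distrib, Finset.sum_add_distrib, ← Finset.mul_sum, ← Finset.mul_sum, N1]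
    ring
  have VW : ∑ k ∈ Finset.range n, v k * w k = N - r * C1 := by
    rw [hN, hC1, Finset.mul_sum, ← Finset.sum_sub_distrib]
    exact Finset.sum_congr rfl (fun k _ => by rw [hvw]; ring)
  have V1 : ∑ k ∈ Finset.range n, (v k - v (k + 1)) ^ 2 =
     2 * ((1 + r ^ 2) * N - 2 * r * C1) - 2 * ((1 + r ^ 2) * C1 - r * N - r * C2) := by
    have : ∑ k ∈ Finset.range n, (v k - v (k + 1)) ^ 2 = ∑ k ∈ Finset.range n,
      (w k ^ 2 + (1 + r) ^ 2 * w (k + 1) ^ 2 + r ^ 2 * w (k + 2) ^ 2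
        - 2 * (1 + r) * (w k * w (k + 1)) - 2 * (1 + r) * r * (w (k + 1) * w (k + 2))
        + 2 * r * (w k * w (k + 2))) :=
      Finset.sum_congr rfl (fun k _ => by rw [hvw, hvw (k + 1)]; ring)
    rw [this, Finset.sum_add_distrib, Finset.sum_sub_distrib, Finset.sum_sub_distrib,
      Finset.sum_add_distrib, Finset.sum_add_distrib]
    simp only [← Finset.mul_sum]
    rw [N1, N2, C11]
    ring
  have P : 0 ≤ 2 * N - 2 * C2 := by
    have : ∑ k ∈ Finset.range n, (w k - w (k + 2)) ^ 2 = 2 * N - 2 * C2 := by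
      have : ∑ k ∈ Finset.range n, (w k - w (k + 2)) ^ 2 = ∑ k ∈ Finset.range n,
        (w k ^ 2 + w (k + 2) ^ 2 - 2 * (w k * w (k + 2))) :=
        Finset.sum_congr rfl (fun k _ => by ring)
      rw [this, Finset.sum_sub_distrib, Finset.sum_add_distrib, ← Finset.mul_sum, N2]
      ring
    rw [← this]; positivity
  rw [V, VW, V1]
  have hr2 : 1 - r ^ 2 ≠ 0 := by nlinarith
  rw [← sub_nonneg]
  have : 2 * ((1 + r ^ 2) * N - 2 * r * C1) / (1 - r) - 2 * (N - r * C1) -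
    r / (1 - r ^ 2) * (2 * ((1 + r ^ 2) * N - 2 * r * C1) - 2 * ((1 + r ^ 2) * C1 - r * N - r * C2))
    = r ^ 2 / (1 - r ^ 2) * (2 * N - 2 * C2) := by
    have : 1 + r ≠ 0 := by linarith
    rw [show 1 - r ^ 2 = (1 - r) * (1 + r) by ring]
    field_simp
    ring
  rw [this]
  have : 0 < 1 - r ^ 2 := by nlinarith
  positivity

lemma dub_reindex (n : ℕ) (r : ℝ) (h : ℕ → ℝ) (hh : ∀ k, h (k + n) = h k) (k : ℕ) (hk : k < n) :
    ∑ d ∈ Finset.range n, r ^ d * h (k + d) =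
      ∑ l ∈ Finset.range n, (if k ≤ l then r ^ (l - k) else r ^ (n + l - k)) * h l := by
  obtain ⟨m, rfl⟩ := Nat.exists_eq_add_of_lt hk
  have e : k + m + 1 = k + (m + 1) := by ring
  have e' : k + m + 1 = (m + 1) + k := by ring
  conv_lhs => rw [e', Finset.sum_range_add]
  conv_rhs => rw [e, Finset.sum_range_add]
  rw [add_comm]
  congr 1
  · refine Finset.sum_congr rfl (fun j hj => ?_)
    rw [Finset.mem_range] at hj
    rw [if_neg (by omega), ← hh j]
    congr 2 <;> omega
  · refine Finset.sum_congr rfl (fun j hj => ?_)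
    rw [if_pos (by omega)]
    congr 2; omega

lemma dub_quad2 (n : ℕ) (r : ℝ) (h0 : 0 < r) (h1 : r < 1) (hn : n ≠ 0) (v : ℕ → ℝ)
    (hv : ∀ k, v (k + n) = v k) :
    ((r + r) / (1 - r ^ 2)) * ∑ k ∈ Finset.range n, (v k - v (k + 1)) ^ 2 ≤
    ∑ k ∈ Finset.range n, ∑ l ∈ Finset.range n,
      ((r ^ Nat.dist k l + r ^ (n - Nat.dist k l)) / (1 - r ^ n)) * (v k - v l) ^ 2 := by
  have Q := dub_quad n r h0 h1 hn v hv
  set B : ℕ → ℕ → ℝ := fun k l => if k ≤ l then r ^ (l - k) else r ^ (n + l - k) with hB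
  have R : ∑ k ∈ Finset.range n, ∑ d ∈ Finset.range n, r ^ d * (v k - v (k + d)) ^ 2 =
    ∑ k ∈ Finset.range n, ∑ l ∈ Finset.range n, B k l * (v k - v l) ^ 2 :=
    Finset.sum_congr rfl (fun k hk => dub_reindex n r (fun l => (v k - v l) ^ 2)
      (fun l => by rw [hv]) k (Finset.mem_range.1 hk))
  have R' : ∑ k ∈ Finset.range n, ∑ l ∈ Finset.range n, B k l * (v k - v l) ^ 2 =
    ∑ k ∈ Finset.range n, ∑ l ∈ Finset.range n, B l k * (v k - v l) ^ 2 := by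
    rw [Finset.sum_comm]
    exact Finset.sum_congr rfl (fun k _ => Finset.sum_congr rfl (fun l _ => by ring))
  have T : ∑ k ∈ Finset.range n, ∑ l ∈ Finset.range n,
      ((r ^ Nat.dist k l + r ^ (n - Nat.dist k l)) / (1 - r ^ n)) * (v k - v l) ^ 2 =
      (∑ k ∈ Finset.range n, ∑ l ∈ Finset.range n, B k l * (v k - v l) ^ 2 +
      ∑ k ∈ Finset.range n, ∑ l ∈ Finset.range n, B l k * (v k - v l) ^ 2) / (1 - r ^ n) := by
    rw [← Finset.sum_add_distrib, Finset.sum_div]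
    refine Finset.sum_congr rfl (fun k hk => ?_)
    rw [← Finset.sum_add_distrib, Finset.sum_div]
    refine Finset.sum_congr rfl (fun l hl => ?_)
    rw [Finset.mem_range] at hk hl
    rw [← add_mul, mul_div_right_comm]
    rcases lt_trichotomy k l with h | h | h
    · simp only [hB]
      rw [if_pos h.le, if_neg (by omega), Nat.dist_eq_sub_of_le h.le,
        show n - (l - k) = n + k - l by omega]
    · subst h; simp
    · simp only [hB]
      rw [if_pos h.le, if_neg (by omega), Nat.dist_eq_sub_of_le_right h.le,
        show n - (k - l) = n + l - k by omega, add_comm]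
  rw [T, ← R', ← R]
  rw [add_div (_ : ℝ) _ (1 - r ^ n), add_div r r, add_mul]
  linarith

lemma dub_cos (n : ℕ) (r : ℝ) (h0 : 0 < r) (h1 : r < 1) (hn : n ≠ 0) (v : ℕ → ℝ)
    (hv : ∀ k, v (k + n) = v k) :
    ((r + r) / (1 - r ^ 2)) * ∑ k ∈ Finset.range n, (1 - Real.cos (v k - v (k + 1))) ≤
    ∑ k ∈ Finset.range n, ∑ l ∈ Finset.range n,
      ((r ^ Nat.dist k l + r ^ (n - Nat.dist k l)) / (1 - r ^ n)) * (1 - Real.cos (v k - v l)) := by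
  have hc := dub_quad2 n r h0 h1 hn (fun k => Real.cos (v k)) (fun k => by rw [hv])
  have hs := dub_quad2 n r h0 h1 hn (fun k => Real.sin (v k)) (fun k => by rw [hv])
  have key : ∀ a b : ℝ, 1 - Real.cos (a - b) =
      ((Real.cos a - Real.cos b) ^ 2 + (Real.sin a - Real.sin b) ^ 2) / 2 := by
    intro a b
    rw [Real.cos_sub]
    linarith [Real.sin_sq_add_cos_sq a, Real.sin_sq_add_cos_sq b]
  simp only [key, mul_add, mul_div_assoc', ← Finset.sum_div, Finset.sum_add_distrib]
  linarith

lemma dub_M_nonneg (a b : ℝ) : 0 ≤ Real.log ((Real.cosh a - Real.cos b) / (1 - Real.cos b)) / 2 := by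
  rcases eq_or_lt_of_le (Real.cos_le_one b) with h | h
  · simp [h]
  · have : 0 < 1 - Real.cos b := by linarith
    refine div_nonneg (Real.log_nonneg ?_) (by norm_num)
    rw [le_div_iff₀ this]
    linarith [Real.one_le_cosh a]

lemma dub_main (n : ℕ) (hn : 2 ≤ n) (T : ℕ → ℝ) (hT : ∀ k, T (k + n) = T k) :
    ∑ k ∈ Finset.range n, Real.log (Real.cosh (Real.pi / 2 * (T k - T (k + 1)))) ≤
    ∑ k ∈ Finset.range n, ∑ l ∈ Finset.range n,
      Real.log ((Real.cosh (2 * Real.pi * (T k - T l) / n) - Real.cos (2 * Real.pi * (Nat.dist k l : ℕ) / n)) /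
          (1 - Real.cos (2 * Real.pi * (Nat.dist k l : ℕ) / n))) / 2 := by
  have h1 : ∀ y : ℝ, ∫⁻ ξ in Ioi (0:ℝ), ENNReal.ofReal ((1 - Real.cos (ξ * y)) / ξ *
      ((Real.exp (-ξ) + Real.exp (-ξ)) / (1 - Real.exp (-ξ) ^ 2))) =
      ENNReal.ofReal (Real.log (Real.cosh (Real.pi / 2 * y))) := by
    intro y
    have := dub_L6 2 1 (by norm_num) (by norm_num) y
    norm_num at this
    rw [this]
    congr 1
    have h2 : Real.cosh (2 * Real.pi * y / 2) + 1 = 2 * Real.cosh (Real.pi / 2 * y) ^ 2 := by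
      rw [show 2 * Real.pi * y / 2 = 2 * (Real.pi / 2 * y) by ring, Real.cosh_two_mul]
      linarith [Real.cosh_sq (Real.pi / 2 * y)]
    rw [h2, mul_div_cancel_left₀ _ (by norm_num), Real.log_pow]
    push_cast; ring
  have h2 : ∀ k ∈ Finset.range n, ∀ l ∈ Finset.range n,
     ∫⁻ ξ in Ioi (0:ℝ), ENNReal.ofReal ((1 - Real.cos (ξ * (T k - T l))) / ξ *
      ((Real.exp (-ξ) ^ Nat.dist k l + Real.exp (-ξ) ^ (n - Nat.dist k l)) / (1 - Real.exp (-ξ) ^ n))) =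
      ENNReal.ofReal (Real.log ((Real.cosh (2 * Real.pi * (T k - T l) / n) - Real.cos (2 * Real.pi * (Nat.dist k l : ℕ) / n)) /
          (1 - Real.cos (2 * Real.pi * (Nat.dist k l : ℕ) / n))) / 2) := by
    intro k hk l hl
    rw [Finset.mem_range] at hk hl
    by_cases h : k = l
    · subst h; simp
    · exact dub_L6 n _ (Nat.dist_pos_of_ne h) (by unfold Nat.dist; omega) _
  rw [← ENNReal.ofReal_le_ofReal_iff (Finset.sum_nonneg fun k _ => Finset.sum_nonneg fun l _ => dub_M_nonneg _ _),
    ENNReal.ofReal_sum_of_nonneg (fun k _ => Real.log_nonneg (Real.one_le_cosh _)),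
    ENNReal.ofReal_sum_of_nonneg (fun k _ => Finset.sum_nonneg fun l _ => dub_M_nonneg _ _)]
  have h3 : ∀ k ∈ Finset.range n, ENNReal.ofReal (∑ l ∈ Finset.range n,
      Real.log ((Real.cosh (2 * Real.pi * (T k - T l) / n) - Real.cos (2 * Real.pi * (Nat.dist k l : ℕ) / n)) /
          (1 - Real.cos (2 * Real.pi * (Nat.dist k l : ℕ) / n))) / 2) =
      ∫⁻ ξ in Ioi (0:ℝ), ∑ l ∈ Finset.range n, ENNReal.ofReal ((1 - Real.cos (ξ * (T k - T l))) / ξ *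
      ((Real.exp (-ξ) ^ Nat.dist k l + Real.exp (-ξ) ^ (n - Nat.dist k l)) / (1 - Real.exp (-ξ) ^ n))) := by
    intro k hk
    rw [ENNReal.ofReal_sum_of_nonneg (fun l _ => dub_M_nonneg _ _),
      lintegral_finsetSum _ (fun l _ => by fun_prop)]
    exact Finset.sum_congr rfl (fun l hl => (h2 k hk l hl).symm)
  rw [Finset.sum_congr rfl h3, Finset.sum_congr rfl (fun k _ => (h1 _).symm),
    ← lintegral_finsetSum _ (fun k _ => by fun_prop), ← lintegral_finsetSum _ (fun k _ => by fun_prop)]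
  refine setLIntegral_mono' measurableSet_Ioi (fun ξ hξ => ?_)
  have hξ : 0 < ξ := hξ
  have hr : Real.exp (-ξ) < 1 := by simpa using hξ
  have hr1 : Real.exp (-ξ) ^ n < 1 := pow_lt_one₀ (Real.exp_pos _).le hr (by omega)
  have hr2 : Real.exp (-ξ) ^ 2 < 1 := pow_lt_one₀ (Real.exp_pos _).le hr (by omega)
  have hc : ∀ y, 0 ≤ (1 - Real.cos (ξ * y)) / ξ := fun y =>
    div_nonneg (by linarith [Real.cos_le_one (ξ * y)]) hξ.le
  have p1 : ∀ k l : ℕ, 0 ≤ (1 - Real.cos (ξ * (T k - T l))) / ξ *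
      ((Real.exp (-ξ) ^ Nat.dist k l + Real.exp (-ξ) ^ (n - Nat.dist k l)) / (1 - Real.exp (-ξ) ^ n)) :=
    fun k l => mul_nonneg (hc _) (div_nonneg (by positivity) (by linarith))
  rw [← ENNReal.ofReal_sum_of_nonneg (fun k _ => mul_nonneg (hc _) (div_nonneg (by positivity) (by linarith))),
    Finset.sum_congr rfl (fun k _ => (ENNReal.ofReal_sum_of_nonneg (fun l _ => p1 k l)).symm),
    ← ENNReal.ofReal_sum_of_nonneg (fun k _ => Finset.sum_nonneg (fun l _ => p1 k l))]
  refine ENNReal.ofReal_le_ofReal ?_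
  have Q := dub_cos n (Real.exp (-ξ)) (Real.exp_pos _) hr (by omega) (fun k => ξ * T k) (fun k => by rw [hT])
  have Q' := mul_le_mul_of_nonneg_left Q (inv_pos.2 hξ).le
  rw [← mul_assoc, Finset.mul_sum, Finset.mul_sum] at Q'
  refine le_trans (le_of_eq ?_) (Q'.trans (le_of_eq ?_))
  · refine Finset.sum_congr rfl (fun k _ => ?_)
    rw [← mul_sub]; ring
  · refine Finset.sum_congr rfl (fun k _ => ?_)
    rw [Finset.mul_sum]
    refine Finset.sum_congr rfl (fun l _ => ?_)
    rw [← mul_sub]; ring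

lemma dub_offDiag {n : ℕ} (f : Fin n → Fin n → ℝ) :
    ∏ p ∈ (Finset.univ : Finset (Fin n)).offDiag, f p.1 p.2 = ∏ k, ∏ l ∈ Finset.univ.erase k, f k l := by
  refine Finset.prod_finset_product' _ _ _ (fun p => ?_)
  simp [eq_comm]

lemma dub_root (n : ℕ) (hn : 2 ≤ n) (ω : ℂ) (hω : IsPrimitiveRoot ω n) (k : Fin n) :
    ∏ l ∈ Finset.univ.erase k, ‖ω ^ ((k : ℕ) + 1) - ω ^ ((l : ℕ) + 1)‖ = n := by
  obtain ⟨m, rfl⟩ : ∃ m, n = m + 1 := ⟨n - 1, by omega⟩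
  have h := congrArg (fun x => ‖x‖) hω.prod_one_sub_pow_eq_order
  simp only [norm_prod] at h
  have h1 : ‖(m : ℂ) + 1‖ = ((m + 1 : ℕ) : ℝ) := by
    rw [← Nat.cast_succ, Complex.norm_natCast]
  rw [h1, Finset.prod_range] at h
  rw [← h]
  symm
  have hnorm : ‖ω‖ = 1 := hω.norm'_eq_one (by omega)
  refine Finset.prod_nbij (fun d : Fin m => k + d.succ) ?_ ?_ ?_ ?_
  · intro d _
    simp [Fin.succ_ne_zero]
  · intro d _ d' _ hd
    simpa using hd
  · intro l hl
    have hl : l ≠ k := by simpa using hl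
    obtain ⟨d, hd⟩ := Fin.exists_succ_eq.2 (sub_ne_zero.2 hl)
    exact ⟨d, by simp, by simp [hd]⟩
  · intro d _
    have : ω ^ (((k + d.succ : Fin (m + 1)) : ℕ) + 1) = ω ^ ((k : ℕ) + 1) * ω ^ ((d : ℕ) + 1) := by
      rw [Fin.val_add, pow_succ, ← pow_eq_pow_mod _ hω.pow_eq_one, Fin.val_succ]
      ring
    rw [this]
    rw [show ω ^ ((k : ℕ) + 1) - ω ^ ((k : ℕ) + 1) * ω ^ ((d : ℕ) + 1) =
      ω ^ ((k : ℕ) + 1) * (1 - ω ^ ((d : ℕ) + 1)) by ring, norm_mul, norm_pow, hnorm, one_pow, one_mul]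

lemma dub_norm_sq (ω : ℂ) (φ : ℝ) (hω : ω = Complex.exp (φ * Complex.I)) (a b : ℝ) (k l : ℕ) :
    ‖(a : ℂ) * ω ^ (k + 1) - (b : ℂ) * ω ^ (l + 1)‖ ^ 2 =
      a ^ 2 + b ^ 2 - 2 * a * b * Real.cos (φ * (Nat.dist k l : ℕ)) := by
  have e : ∀ j : ℕ, ω ^ j = Real.cos (j * φ) + Real.sin (j * φ) * Complex.I := by
    intro j
    rw [hω, ← Complex.exp_nat_mul, ← mul_assoc, Complex.exp_mul_I]
    push_cast; rfl
  have hc : Real.cos (φ * (Nat.dist k l : ℕ)) = Real.cos (((k + 1 : ℕ) : ℝ) * φ - ((l + 1 : ℕ) : ℝ) * φ) := by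
    rcases le_total k l with h | h
    · rw [Nat.dist_eq_sub_of_le h, Nat.cast_sub h, ← Real.cos_neg]
      congr 1; push_cast; ring
    · rw [Nat.dist_eq_sub_of_le_right h, Nat.cast_sub h]
      congr 1; push_cast; ring
  rw [hc, Real.cos_sub, e, e, ← Complex.normSq_eq_norm_sq, Complex.normSq_apply]
  simp only [Complex.add_re, Complex.add_im, Complex.sub_re, Complex.sub_im, Complex.mul_re, Complex.mul_im, Complex.ofReal_re,
      Complex.ofReal_im, Complex.I_re, Complex.I_im]
  have s1 := Real.sin_sq_add_cos_sq (((k + 1 : ℕ) : ℝ) * φ)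
  have s2 := Real.sin_sq_add_cos_sq (((l + 1 : ℕ) : ℝ) * φ)
  linear_combination a ^ 2 * s1 + b ^ 2 * s2

lemma dub_pair (n : ℕ) (ω : ℂ) (hω : ω = Complex.exp ((2 * Real.pi / n : ℝ) * Complex.I))
    (x y : ℝ) (k l : ℕ) (hk : k < n) (hl : l < n) (hkl : k ≠ l) :
    ‖(Real.exp x : ℂ) * ω ^ (k + 1) - (Real.exp y : ℂ) * ω ^ (l + 1)‖ =
     Real.exp (x / 2 + y / 2) * ‖ω ^ (k + 1) - ω ^ (l + 1)‖ *
       Real.exp (Real.log ((Real.cosh (x - y) - Real.cos (2 * Real.pi * (Nat.dist k l : ℕ) / n)) /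
          (1 - Real.cos (2 * Real.pi * (Nat.dist k l : ℕ) / n))) / 2) := by
  refine (pow_left_inj₀ (norm_nonneg _) (by positivity) two_ne_zero).1 ?_
  have hn : (0:ℝ) < n := by exact_mod_cast (by omega : 0 < n)
  rw [mul_pow, mul_pow, dub_norm_sq ω _ hω]
  have h1 := dub_norm_sq ω _ hω 1 1 k l
  simp only [Complex.ofReal_one, one_mul] at h1
  rw [h1, show 2 * Real.pi / n * (Nat.dist k l : ℕ) = 2 * Real.pi * (Nat.dist k l : ℕ) / n by ring]
  have hd0 : (0:ℝ) < (Nat.dist k l : ℕ) := by exact_mod_cast Nat.dist_pos_of_ne hkl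
  have hdn : ((Nat.dist k l : ℕ) : ℝ) < n := by
    have : Nat.dist k l < n := by unfold Nat.dist; omega
    exact_mod_cast this
  set θ := 2 * Real.pi * (Nat.dist k l : ℕ) / n with hθ
  have hθ0 : 0 < θ := by have := Real.pi_pos; positivity
  have hθ1 : θ < 2 * Real.pi := by
    rw [hθ, div_lt_iff₀ hn]
    have := Real.pi_pos
    gcongr
  have hc : 0 < 1 - Real.cos θ := by
    have hs : 0 < Real.sin (θ / 2) := Real.sin_pos_of_pos_of_lt_pi (by linarith) (by linarith)
    have : Real.cos θ = 1 - 2 * Real.sin (θ / 2) ^ 2 := by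
      rw [show θ = 2 * (θ / 2) by ring, Real.cos_two_mul, show 2 * (θ / 2) / 2 = θ / 2 by ring]
      linarith [Real.sin_sq_add_cos_sq (θ / 2)]
    rw [this]
    have := pow_pos hs 2
    linarith
  have hc1 : 0 < Real.cosh (x - y) - Real.cos θ := by linarith [Real.one_le_cosh (x - y)]
  rw [← Real.exp_nat_mul (x / 2 + y / 2), ← Real.exp_nat_mul (Real.log _ / 2)]
  push_cast
  rw [mul_div_cancel₀ _ (by norm_num : (2:ℝ) ≠ 0), Real.exp_log (by positivity),
    show 2 * (x / 2 + y / 2) = x + y by ring]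
  have : Real.exp (x + y) * (2 * Real.cosh (x - y)) = Real.exp x ^ 2 + Real.exp y ^ 2 := by
    rw [Real.cosh_eq, mul_div_cancel₀ _ (by norm_num : (2:ℝ) ≠ 0), mul_add, ← Real.exp_add, ← Real.exp_add,
      ← Real.exp_nat_mul, ← Real.exp_nat_mul]
    congr 2 <;> · push_cast; ring
  rw [← this, mul_assoc 2 (Real.exp x), ← Real.exp_add]
  field_simp
  ring

lemma dub_rhs (n x y : ℝ) :
    Real.exp x ^ (n / 2 - 1) * (Real.exp x ^ (n / 2) + Real.exp y ^ (n / 2)) =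
     Real.exp ((3 * n / 4 - 1) * x + n / 4 * y) * 2 * Real.cosh (n / 4 * (x - y)) := by
  rw [← Real.exp_mul, ← Real.exp_mul, ← Real.exp_mul, Real.cosh_eq, mul_assoc,
    mul_div_cancel₀ _ (by norm_num : (2:ℝ) ≠ 0), mul_add, mul_add, ← Real.exp_add, ← Real.exp_add,
    ← Real.exp_add, ← Real.exp_add]
  congr 2 <;> ring

lemma dub_final (n : ℕ) (hn : 2 ≤ n) (t : Fin n → ℝ)
    (ht : ∀ k, 0 < t k) (σ : Fin n → Fin n) (hσ : ∀ k, (σ k : ℕ) = ((k : ℕ) + 1) % n)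
    (ω : ℂ) (hω : ω = Complex.exp (2 * Real.pi * Complex.I / n))
    (z : Fin n → ℂ) (hz : ∀ k, z k = (t k : ℂ) * ω ^ ((k : ℕ) + 1)) :
    ∃ E S S' : ℝ, 0 < E ∧ S' ≤ S ∧ ((∀ k l, t k = t l) → S = S') ∧
    (∏ p ∈ (Finset.univ : Finset (Fin n)).offDiag, ‖z p.1 - z p.2‖) = E * Real.exp S ∧
      ((n : ℝ) / 2) ^ n *
        ∏ k : Fin n, t k ^ ((n : ℝ) / 2 - 1) *
          (t k ^ ((n : ℝ) / 2) +
            t (σ k) ^ ((n : ℝ) / 2)) = E * Real.exp S' := by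
  have hn0 : 0 < n := by omega
  have hnR : (0:ℝ) < n := by exact_mod_cast hn0
  have hpi := Real.pi_pos
  obtain ⟨X, hX⟩ : ∃ X : ℕ → ℝ, ∀ k, X k = Real.log (t ⟨k % n, Nat.mod_lt _ hn0⟩) := ⟨_, fun _ => rfl⟩
  have hXp : ∀ k, X (k + n) = X k := by
    intro k; rw [hX, hX]; congr 2; simp
  have htX : ∀ k : Fin n, t k = Real.exp (X k) := by
    intro k
    rw [hX, Real.exp_log (ht _)]
    congr 1
    apply Fin.ext
    simp [Nat.mod_eq_of_lt k.2]
  have htX' : ∀ k : Fin n, t (σ k) = Real.exp (X (k + 1)) := by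
    intro k
    rw [hX, Real.exp_log (ht _)]
    congr 1
    exact Fin.ext (hσ k)
  have hω' : ω = Complex.exp ((2 * Real.pi / n : ℝ) * Complex.I) := by
    rw [hω]; congr 1; push_cast; ring
  have hprim : IsPrimitiveRoot ω n := by rw [hω]; exact Complex.isPrimitiveRoot_exp n (by omega)
  set M : ℕ → ℕ → ℝ := fun k l => Real.log ((Real.cosh (X k - X l) - Real.cos (2 * Real.pi * (Nat.dist k l : ℕ) / n)) /
          (1 - Real.cos (2 * Real.pi * (Nat.dist k l : ℕ) / n))) / 2 with hM
  have hMd : ∀ k, M k k = 0 := by intro k; simp [hM]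
  refine ⟨Real.exp ((n - 1) * ∑ k ∈ Finset.range n, X k) * n ^ n,
    ∑ k ∈ Finset.range n, ∑ l ∈ Finset.range n, M k l,
    ∑ k ∈ Finset.range n, Real.log (Real.cosh (n / 4 * (X k - X (k + 1)))), by positivity, ?_, ?_, ?_, ?_⟩
  · have := dub_main n hn (fun k => n / (2 * Real.pi) * X k) (fun k => by rw [hXp])
    refine le_trans (le_of_eq ?_) (this.trans (le_of_eq ?_))
    · refine Finset.sum_congr rfl (fun k _ => ?_)
      congr 2; field_simp; ring
    · refine Finset.sum_congr rfl (fun k _ => Finset.sum_congr rfl (fun l _ => ?_))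
      simp only [hM]
      congr 5; field_simp
  · intro he
    have hXe : ∀ k l, X k = X l := by
      intro k l; rw [hX, hX, he]
    rw [Finset.sum_eq_zero, Finset.sum_eq_zero]
    · intro k _
      rw [hXe k (k + 1)]; simp
    · intro k _
      refine Finset.sum_eq_zero (fun l _ => ?_)
      simp only [hM]
      rw [hXe k l, sub_self, Real.cosh_zero]
      by_cases h : 1 - Real.cos (2 * Real.pi * (Nat.dist k l : ℕ) / n) = 0
      · rw [h]; simp
      · rw [div_self h]; simp
  · have h1 : ∏ p ∈ (Finset.univ : Finset (Fin n)).offDiag, ‖z p.1 - z p.2‖ =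
      ∏ p ∈ (Finset.univ : Finset (Fin n)).offDiag,
        (fun k l : Fin n => Real.exp (X k / 2 + X l / 2) * ‖ω ^ ((k : ℕ) + 1) - ω ^ ((l : ℕ) + 1)‖ * Real.exp (M k l)) p.1 p.2 := by
      refine Finset.prod_congr rfl (fun p hp => ?_)
      have hp : p.1 ≠ p.2 := (Finset.mem_offDiag.1 hp).2.2
      rw [hz, hz, htX, htX]
      exact dub_pair n ω hω' _ _ _ _ p.1.2 p.2.2 (fun h => hp (Fin.ext h))
    rw [h1, dub_offDiag (fun k l : Fin n => Real.exp (X k / 2 + X l / 2) * ‖ω ^ ((k : ℕ) + 1) - ω ^ ((l : ℕ) + 1)‖ * Real.exp (M k l))]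
    simp only [Finset.prod_mul_distrib]
    rw [Finset.prod_congr rfl (fun k _ => dub_root n hn ω hprim k)]
    simp only [← Real.exp_sum]
    rw [Finset.prod_const, Finset.card_univ, Fintype.card_fin]
    have g1 : ∑ k : Fin n, ∑ l ∈ Finset.univ.erase k, (X k / 2 + X l / 2) = (n - 1) * ∑ k ∈ Finset.range n, X k := by
      have h2 : ∀ k : Fin n, ∑ l ∈ Finset.univ.erase k, (X k / 2 + X l / 2) =
          (∑ l : Fin n, X l) / 2 + (n - 2) / 2 * X k := by
        intro k
        rw [Finset.sum_erase_eq_sub (Finset.mem_univ k), Finset.sum_add_distrib, ← Finset.sum_div, ← Finset.sum_div]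
        simp
        ring
      rw [Finset.sum_congr rfl (fun k _ => h2 k), Finset.sum_add_distrib, ← Finset.mul_sum, Finset.sum_range]
      simp
      ring
    have g2 : ∑ k : Fin n, ∑ l ∈ Finset.univ.erase k, M k l = ∑ k ∈ Finset.range n, ∑ l ∈ Finset.range n, M k l := by
      rw [Finset.sum_range]
      refine Finset.sum_congr rfl (fun k _ => ?_)
      rw [Finset.sum_range]
      exact Finset.sum_erase (f := fun l : Fin n => M k l) _ (hMd k)
    rw [g1, g2]
  · have h1 : ∀ k : Fin n, t k ^ ((n : ℝ) / 2 - 1) *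
          (t k ^ ((n : ℝ) / 2) +
            t (σ k) ^ ((n : ℝ) / 2)) =
         Real.exp ((3 * n / 4 - 1) * X k + n / 4 * X (k + 1)) * 2 *
           Real.exp (Real.log (Real.cosh (n / 4 * (X k - X (k + 1))))) := by
      intro k
      rw [htX', htX, dub_rhs, Real.exp_log (Real.cosh_pos _)]
    rw [Finset.prod_congr rfl (fun k _ => h1 k)]
    simp only [Finset.prod_mul_distrib]
    simp only [← Real.exp_sum]
    rw [Finset.prod_const, Finset.card_univ, Fintype.card_fin, ← Finset.sum_range (fun k => Real.log (Real.cosh (n / 4 * (X k - X (k + 1))))),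
      ← Finset.sum_range (fun k => (3 * n / 4 - 1) * X k + n / 4 * X (k + 1)),
      Finset.sum_add_distrib, ← Finset.mul_sum, ← Finset.mul_sum, dub_shift n X hXp, div_pow]
    rw [show (3 * (n:ℝ) / 4 - 1) * ∑ k ∈ Finset.range n, X k + n / 4 * ∑ k ∈ Finset.range n, X k =
      (n - 1) * ∑ k ∈ Finset.range n, X k by ring]
    field_simp

end DubininAux


/-- A strengthening of inequality (11) of the paper: for nonzero points
`z k = t k * ω^k` on the `n` equally spaced rays (one point per ray, `t k > 0`,
indices taken cyclically so that `t (n+1) = t 1`), the product of mutual distances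
over all ordered pairs of distinct indices satisfies
`∏_{k ≠ l} |z k - z l| ≥ (n/2)^n * ∏ k, t k ^ (n/2 - 1) * (t k ^ (n/2) + t (k+1) ^ (n/2))`,
where the powers of the positive reals `t k` are real powers. Equality holds when all
`t k` are equal. -/
theorem dubinin_ineq_11_strengthened (n : ℕ) (hn : 2 ≤ n) (t : Fin n → ℝ)
    (ht : ∀ k, 0 < t k)
    (ω : ℂ) (hω : ω = Complex.exp (2 * Real.pi * Complex.I / n))
    (z : Fin n → ℂ) (hz : ∀ k, z k = (t k : ℂ) * ω ^ ((k : ℕ) + 1)) :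
    (∏ p ∈ (Finset.univ : Finset (Fin n)).offDiag, ‖z p.1 - z p.2‖) ≥
      ((n : ℝ) / 2) ^ n *
        ∏ k : Fin n, t k ^ ((n : ℝ) / 2 - 1) *
          (t k ^ ((n : ℝ) / 2) +
            t ⟨((k : ℕ) + 1) % n, Nat.mod_lt _ (by omega)⟩ ^ ((n : ℝ) / 2)) ∧
    ((∀ k l, t k = t l) →
      (∏ p ∈ (Finset.univ : Finset (Fin n)).offDiag, ‖z p.1 - z p.2‖) =
        ((n : ℝ) / 2) ^ n *
          ∏ k : Fin n, t k ^ ((n : ℝ) / 2 - 1) *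
            (t k ^ ((n : ℝ) / 2) +
              t ⟨((k : ℕ) + 1) % n, Nat.mod_lt _ (by omega)⟩ ^ ((n : ℝ) / 2))) := by
  obtain ⟨E, S, S', hE, hS, heq, h1, h2⟩ := dub_final n hn t ht
    (fun k => ⟨((k : ℕ) + 1) % n, Nat.mod_lt _ (by omega)⟩) (fun _ => rfl) ω hω z hz
  refine ⟨?_, fun h => by rw [h1, heq h]; exact h2.symm⟩
  rw [h1]
  refine le_trans (le_of_eq h2) ?_
  exact mul_le_mul_of_nonneg_left (Real.exp_le_exp.2 hS) hE.le
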